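/- Fix K ≥ 1 and positive reals σ_1², …, σ_K². For each M > K, let Ĝ_M be a random M×K complex matrix whose entries are mutually independent, with every entry in column k distributed as CN(0, σ_k²), and let Π be the K×K cyclic permutation matrix mapping the k-th standard basis vector to the (k+1 mod K)-th. Then, as M → ∞, M(M−K) · E{ Tr[ Π (Ĝ_M^H Ĝ_M)^{-1} Π^H (Ĝ_M^T Ĝ_M^*)^{-1} ] } converges to ϱ := Σ_{k'=1}^{K} 1/( σ_{k'}² σ_{k'+1}² ), where the index k'+1 is taken modulo K. -/

import Mathlib

open MeasureTheory ProbabilityTheory Matrix Filter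

/-- Matrices inherit the (pi) measurable structure of functions. -/
instance matrixMeasurableSpace {m n α : Type*} [MeasurableSpace α] :
    MeasurableSpace (Matrix m n α) :=
  inferInstanceAs (MeasurableSpace (m → n → α))

/-- The circularly-symmetric complex Gaussian distribution `CN(0, v)`:
real and imaginary parts are independent real Gaussians, each of variance `v/2`. -/
noncomputable def complexGaussian (v : ℝ) : Measure ℂ :=
  Measure.map (fun p : ℝ × ℝ => ⟨p.1, p.2⟩)
    ((gaussianReal 0 (v / 2).toNNReal).prod (gaussianReal 0 (v / 2).toNNReal))


open scoped ENNReal NNReal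

lemma aux_gauss_lintegral (b c : ℝ) (hb : 0 < b) :
    ∫⁻ x : ℝ, ENNReal.ofReal (Real.exp (-b * (x + c) ^ 2)) = ENNReal.ofReal √(Real.pi / b) := by
  rw [lintegral_add_right_eq_self (fun x : ℝ => ENNReal.ofReal (Real.exp (-b * x ^ 2))) c,
    ← integral_gaussian, ofReal_integral_eq_lintegral_ofReal (integrable_exp_neg_mul_sq hb)]
  exact ae_of_all _ fun x => (Real.exp_pos _).le

lemma aux_gauss_real (τ t α : ℝ) (hτ : 0 < τ) (ht : 0 < 1 + 2 * t * τ) (hα : 0 ≤ t * α ^ 2) :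
    ∫⁻ x, ENNReal.ofReal (Real.exp (-t * (α + x) ^ 2)) ∂(gaussianReal 0 τ.toNNReal)
      ≤ ENNReal.ofReal (√(1 + 2 * t * τ))⁻¹ := by
  have hv : τ.toNNReal ≠ 0 := by simpa using hτ
  rw [gaussianReal_of_var_ne_zero _ hv, lintegral_withDensity_eq_lintegral_mul _
    (measurable_gaussianPDF _ _) (by fun_prop)]
  set b : ℝ := t + 1 / (2 * τ) with hbdef
  have hb : 0 < b := by
    have : b = (1 + 2 * t * τ) / (2 * τ) := by rw [hbdef]; field_simp; ring
    rw [this]; positivity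
  calc _ ≤ ∫⁻ x : ℝ, ENNReal.ofReal (√(2 * Real.pi * τ))⁻¹ *
        ENNReal.ofReal (Real.exp (-b * (x + t * α / b) ^ 2)) := by
        apply lintegral_mono
        intro x
        simp only [Pi.mul_apply, gaussianPDF, gaussianPDFReal]
        rw [← ENNReal.ofReal_mul (by positivity), ← ENNReal.ofReal_mul (by positivity)]
        apply ENNReal.ofReal_le_ofReal
        rw [Real.coe_toNNReal _ hτ.le, mul_assoc, ← Real.exp_add]
        gcongr
        have e : -(x - 0) ^ 2 / (2 * τ) + -t * (α + x) ^ 2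
          = -b * (x + t * α / b) ^ 2 - t * α ^ 2 / (2 * τ * b) := by
          have h1 : 1 / (2 * τ) = b - t := by rw [hbdef]; ring
          have h2 : -(x - 0) ^ 2 / (2 * τ) = - x ^ 2 * (b - t) := by rw [← h1]; ring
          have h3 : t * α ^ 2 / (2 * τ * b) = t * α ^ 2 * (b - t) / b := by
            rw [← h1]; field_simp
          rw [h2, h3]
          field_simp
          ring
        rw [e]
        have : 0 ≤ t * α ^ 2 / (2 * τ * b) := by positivity
        linarith
    _ = _ := by
        rw [lintegral_const_mul _ (by fun_prop), aux_gauss_lintegral _ _ hb,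
          ← ENNReal.ofReal_mul (by positivity)]
        congr 1
        rw [← Real.sqrt_inv, ← Real.sqrt_inv, ← Real.sqrt_mul (by positivity)]
        congr 1
        have : 1 + 2 * t * τ = 2 * τ * b := by rw [hbdef]; field_simp; ring
        rw [this]
        field_simp

lemma aux_meas_mk : Measurable (fun p : ℝ × ℝ => (⟨p.1, p.2⟩ : ℂ)) :=
  Complex.measurableEquivRealProd.symm.measurable

lemma aux_gauss_cplx (s t : ℝ) (z : ℂ) (hs : 0 < s) (ht : 0 < 1 + t * s)
    (hz : 0 ≤ t ∨ z = 0) :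
    ∫⁻ x, ENNReal.ofReal (Real.exp (-t * ‖z + x‖ ^ 2)) ∂(complexGaussian s)
      ≤ ENNReal.ofReal (1 + t * s)⁻¹ := by
  rw [complexGaussian, lintegral_map (by fun_prop) aux_meas_mk]
  have e : ∀ p : ℝ × ℝ, ENNReal.ofReal (Real.exp (-t * ‖z + (⟨p.1, p.2⟩ : ℂ)‖ ^ 2))
      = ENNReal.ofReal (Real.exp (-t * (z.re + p.1) ^ 2)) *
        ENNReal.ofReal (Real.exp (-t * (z.im + p.2) ^ 2)) := by
    intro p
    rw [← ENNReal.ofReal_mul (by positivity), ← Real.exp_add, Complex.sq_norm,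
      Complex.normSq_apply]
    congr 2
    simp
    ring
  simp_rw [e]
  rw [lintegral_prod_mul (f := fun x : ℝ => ENNReal.ofReal (Real.exp (-t * (z.re + x) ^ 2)))
    (g := fun x : ℝ => ENNReal.ofReal (Real.exp (-t * (z.im + x) ^ 2)))
    (by fun_prop) (by fun_prop)]
  have h2 : 1 + 2 * t * (s / 2) = 1 + t * s := by ring
  have hr : 0 ≤ t * z.re ^ 2 := by
    rcases hz with h | h
    · positivity
    · simp [h]
  have hi : 0 ≤ t * z.im ^ 2 := by
    rcases hz with h | h
    · positivity
    · simp [h]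
  have a1 := aux_gauss_real (s / 2) t z.re (by positivity) (by linarith) hr
  have a2 := aux_gauss_real (s / 2) t z.im (by positivity) (by linarith) hi
  rw [h2] at a1 a2
  refine (mul_le_mul' a1 a2).trans ?_
  rw [← ENNReal.ofReal_mul (by positivity), ← mul_inv, Real.mul_self_sqrt ht.le]

instance aux_prob (s : ℝ) : IsProbabilityMeasure (complexGaussian s) :=
  Measure.isProbabilityMeasure_map aux_meas_mk.aemeasurable

lemma aux_map_re (s : ℝ) : (complexGaussian s).map Complex.re = gaussianReal 0 (s / 2).toNNReal := by
  rw [complexGaussian, Measure.map_map (by fun_prop) aux_meas_mk]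
  exact Measure.map_fst_prod.trans (by simp)

lemma aux_map_im (s : ℝ) : (complexGaussian s).map Complex.im = gaussianReal 0 (s / 2).toNNReal := by
  rw [complexGaussian, Measure.map_map (by fun_prop) aux_meas_mk]
  exact Measure.map_snd_prod.trans (by simp)

lemma aux_memLp_re (s : ℝ) (p : ℝ≥0) : MemLp Complex.re p (complexGaussian s) := by
  have := memLp_id_gaussianReal (μ := 0) (v := (s / 2).toNNReal) p
  rw [← aux_map_re s, memLp_map_measure_iff (by fun_prop) (by fun_prop)] at this
  exact this

lemma aux_memLp_im (s : ℝ) (p : ℝ≥0) : MemLp Complex.im p (complexGaussian s) := by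
  have := memLp_id_gaussianReal (μ := 0) (v := (s / 2).toNNReal) p
  rw [← aux_map_im s, memLp_map_measure_iff (by fun_prop) (by fun_prop)] at this
  exact this

lemma aux_memLp (s : ℝ) (p : ℝ≥0) : MemLp (fun z : ℂ => z) p (complexGaussian s) := by
  have h := (aux_memLp_re s p).norm.add (aux_memLp_im s p).norm
  refine h.mono (by fun_prop) (ae_of_all _ fun z => ?_)
  simp only [Pi.add_apply, Real.norm_eq_abs]
  rw [abs_of_nonneg (by positivity : (0 : ℝ) ≤ |z.re| + |z.im|)]
  exact Complex.norm_le_abs_re_add_abs_im z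

lemma aux_mean (s : ℝ) : ∫ z, z ∂(complexGaussian s) = 0 := by
  have hi : Integrable (fun z : ℂ => z) (complexGaussian s) :=
    memLp_one_iff_integrable.1 (by exact_mod_cast aux_memLp s 1)
  apply Complex.ext
  · have h1 : (∫ z, z ∂(complexGaussian s)).re = ∫ z, z.re ∂(complexGaussian s) :=
      (integral_re hi).symm
    have h2 := integral_id_gaussianReal (μ := 0) (v := (s / 2).toNNReal)
    rw [← aux_map_re s, integral_map (by fun_prop) (by fun_prop)] at h2
    simpa [h2] using h1
  · have h1 : (∫ z, z ∂(complexGaussian s)).im = ∫ z, z.im ∂(complexGaussian s) :=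
      (integral_im hi).symm
    have h2 := integral_id_gaussianReal (μ := 0) (v := (s / 2).toNNReal)
    rw [← aux_map_im s, integral_map (by fun_prop) (by fun_prop)] at h2
    simpa [h2] using h1

lemma aux_sq_real (v : ℝ≥0) : ∫ x, x ^ 2 ∂(gaussianReal 0 v) = v := by
  have h := variance_fun_id_gaussianReal (μ := 0) (v := v)
  rw [variance_eq_integral (by fun_prop)] at h
  simpa using h

lemma aux_second (s : ℝ) (hs : 0 < s) : ∫ z : ℂ, ‖z‖ ^ 2 ∂(complexGaussian s) = s := by
  have e : ∀ z : ℂ, ‖z‖ ^ 2 = z.re ^ 2 + z.im ^ 2 := by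
    intro z; rw [Complex.sq_norm, Complex.normSq_apply]; ring
  simp_rw [e]
  rw [integral_add (by exact_mod_cast (aux_memLp_re s 2).integrable_sq)
    (by exact_mod_cast (aux_memLp_im s 2).integrable_sq)]
  have h1 := aux_sq_real (s / 2).toNNReal
  have h2 := aux_sq_real (s / 2).toNNReal
  rw [← aux_map_re s, integral_map (by fun_prop) (by fun_prop)] at h1
  rw [← aux_map_im s, integral_map (by fun_prop) (by fun_prop)] at h2
  rw [h1, h2, Real.coe_toNNReal _ (by positivity)]
  ring

/-- The quadratic form `‖X u‖²`. -/
noncomputable def qform {M K : ℕ} (X : Matrix (Fin M) (Fin K) ℂ) (u : Fin K → ℂ) : ℝ :=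
  ∑ i, ‖∑ k, X i k * u k‖ ^ 2

/-- The squared Frobenius norm. -/
noncomputable def fro {M K : ℕ} (X : Matrix (Fin M) (Fin K) ℂ) : ℝ :=
  ∑ p : Fin M × Fin K, ‖X p.1 p.2‖ ^ 2

lemma qform_nonneg {M K : ℕ} (X : Matrix (Fin M) (Fin K) ℂ) (u : Fin K → ℂ) : 0 ≤ qform X u := by
  unfold qform; positivity

lemma qform_add {M K : ℕ} (X : Matrix (Fin M) (Fin K) ℂ) (u v : Fin K → ℂ) :
    qform X (u + v) ≤ 2 * qform X u + 2 * qform X v := by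
  unfold qform
  rw [Finset.mul_sum, Finset.mul_sum, ← Finset.sum_add_distrib]
  apply Finset.sum_le_sum
  intro i _
  simp only [Pi.add_apply, mul_add, Finset.sum_add_distrib]
  have h := norm_add_le (∑ k, X i k * u k) (∑ k, X i k * v k)
  have h2 := norm_nonneg (∑ k, X i k * u k + ∑ k, X i k * v k)
  nlinarith [sq_nonneg (‖∑ k, X i k * u k‖ - ‖∑ k, X i k * v k‖)]

lemma qform_le {M K : ℕ} (X : Matrix (Fin M) (Fin K) ℂ) (u : Fin K → ℂ) (hu : ‖u‖ ≤ 1) :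
    qform X u ≤ K * fro X := by
  unfold qform fro
  rw [Fintype.sum_prod_type, Finset.mul_sum]
  apply Finset.sum_le_sum
  intro i _
  have h1 : ‖∑ k, X i k * u k‖ ≤ ∑ k, ‖X i k‖ := by
    refine (norm_sum_le _ _).trans (Finset.sum_le_sum fun k _ => ?_)
    rw [norm_mul]
    have := (norm_le_pi_norm u k).trans hu
    exact mul_le_of_le_one_right (norm_nonneg _) this
  have h2 := sq_sum_le_card_mul_sum_sq (s := Finset.univ) (f := fun k => ‖X i k‖)
  simp only [Finset.card_univ, Fintype.card_fin] at h2
  exact (pow_le_pow_left₀ (norm_nonneg _) h1 2).trans h2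

lemma qform_smul {M K : ℕ} (X : Matrix (Fin M) (Fin K) ℂ) (u : Fin K → ℂ) (c : ℂ) :
    qform X (c • u) = ‖c‖ ^ 2 * qform X u := by
  unfold qform
  rw [Finset.mul_sum]
  refine Finset.sum_congr rfl fun i _ => ?_
  rw [← mul_pow, ← norm_mul, Finset.mul_sum]
  congr 2
  refine Finset.sum_congr rfl fun k _ => ?_
  simp; ring

lemma qform_eq {M K : ℕ} (X : Matrix (Fin M) (Fin K) ℂ) (u : Fin K → ℂ) :
    (qform X u : ℂ) = star u ⬝ᵥ ((Xᴴ * X) *ᵥ u) := by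
  rw [← Matrix.mulVec_mulVec, Matrix.dotProduct_mulVec, ← Matrix.star_mulVec]
  unfold qform
  simp only [dotProduct, Matrix.mulVec, Pi.star_apply]
  push_cast
  refine Finset.sum_congr rfl fun i _ => ?_
  rw [← Complex.conj_mul']
  rfl

/-- The weighted Gaussian integral associated with `X`. -/
noncomputable def Jint {M K : ℕ} (X : Matrix (Fin M) (Fin K) ℂ) : ℝ≥0∞ :=
  ∫⁻ u : Fin K → ℂ, ENNReal.ofReal ((1 + ‖u‖) ^ 16 * Real.exp (-(qform X u / M)))

lemma J_lower {M K : ℕ} (hM : 0 < M) (X : Matrix (Fin M) (Fin K) ℂ) (w : Fin K → ℂ)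
    (hw : qform X w ≤ M) :
    ENNReal.ofReal (‖w‖ ^ 16 * Real.exp (-2 - 2 * K * fro X / M)) *
      volume (Metric.closedBall (0 : Fin K → ℂ) 1) ≤ Jint X := by
  have hM' : (0 : ℝ) < M := by exact_mod_cast hM
  have hv : volume (Metric.closedBall (0 : Fin K → ℂ) 1)
      = volume (Metric.closedBall w 1) :=
    (Measure.addHaar_closedBall_center volume w 1).symm
  rw [hv, ← setLIntegral_const]
  refine le_trans ?_ (setLIntegral_le_lintegral (Metric.closedBall w 1) _)
  refine setLIntegral_mono' Metric.isClosed_closedBall.measurableSet fun u hu => ?_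
  apply ENNReal.ofReal_le_ofReal
  rw [Metric.mem_closedBall, dist_eq_norm] at hu
  have h1 : ‖w‖ ≤ 1 + ‖u‖ := by
    have := norm_sub_norm_le w u
    rw [norm_sub_rev] at this
    linarith
  gcongr
  have h2 := qform_add X w (u - w)
  rw [add_sub_cancel] at h2
  have h3 := qform_le X (u - w) hu
  have h4 : qform X u / M ≤ (2 * M + 2 * (K * fro X)) / M := by
    gcongr
    linarith
  have h5 : (2 * M + 2 * (K * fro X)) / M = 2 + 2 * K * fro X / M := by
    field_simp
  linarith

lemma det_and_bound {M K : ℕ} (hM : 0 < M) (X : Matrix (Fin M) (Fin K) ℂ) (H : ℝ)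
    (hH : ∀ w, qform X w ≤ M → ‖w‖ ^ 8 ≤ H) :
    IsUnit (Xᴴ * X).det ∧ ∀ j k, ‖(M : ℂ) * (Xᴴ * X)⁻¹ j k‖ ^ 4 ≤ H := by
  have hM' : (0 : ℝ) < M := by exact_mod_cast hM
  have hdet : (Xᴴ * X).det ≠ 0 := by
    intro h0
    obtain ⟨v, hv, hv0⟩ := Matrix.exists_mulVec_eq_zero_iff.2 h0
    have hq : qform X v = 0 := by
      have := qform_eq X v
      rw [hv0, dotProduct_zero] at this
      exact_mod_cast this
    have hvn : 0 < ‖v‖ := norm_pos_iff.2 hv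
    have h1 : ∀ t : ℝ, 1 ≤ t → t ≤ H := by
      intro t ht
      have := hH (((t / ‖v‖ : ℝ) : ℂ) • v) (by rw [qform_smul, hq]; simp)
      rw [norm_smul, Complex.norm_real, Real.norm_of_nonneg (by positivity),
        div_mul_cancel₀ _ hvn.ne'] at this
      refine le_trans ?_ this
      exact le_self_pow₀ ht (by norm_num)
    have := h1 (max 1 (H + 1)) (le_max_left _ _)
    have := le_max_right 1 (H + 1)
    linarith
  have hU : IsUnit (Xᴴ * X).det := isUnit_iff_ne_zero.2 hdet
  refine ⟨hU, fun j k => ?_⟩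
  set A := Xᴴ * X with hA
  set b : Fin K → ℂ := fun j => A⁻¹ j k with hb
  have hAb : A *ᵥ b = Pi.single k 1 := by
    have h1 : b = A⁻¹ *ᵥ Pi.single k 1 := by
      ext j; simp [hb]
    rw [h1, Matrix.mulVec_mulVec, Matrix.mul_nonsing_inv _ hU, Matrix.one_mulVec]
  have hq : (qform X b : ℂ) = star (b k) := by
    rw [qform_eq, ← hA, hAb]; simp
  set S := qform X b with hS
  have hS0 : 0 ≤ S := qform_nonneg _ _
  have hbk : b k = (S : ℂ) := by
    have := congrArg star hq
    rw [star_star] at this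
    rw [← this]; simp
  have hSpos : 0 < S := by
    rcases hS0.lt_or_eq with h | h
    · exact h
    · exfalso
      have hXb : X *ᵥ b = 0 := by
        have hs : ∑ i, ‖∑ k, X i k * b k‖ ^ 2 = 0 := h.symm
        rw [Finset.sum_eq_zero_iff_of_nonneg (fun _ _ => by positivity)] at hs
        ext i
        have := hs i (Finset.mem_univ _)
        simpa [Matrix.mulVec, dotProduct] using this
      have : A *ᵥ b = 0 := by
        rw [hA, ← Matrix.mulVec_mulVec, hXb, Matrix.mulVec_zero]
      rw [hAb] at this
      have := congrFun this k
      simp at this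
  have hw := hH (((√(M / S) : ℝ) : ℂ) • b) (by
    rw [qform_smul, Complex.norm_real, Real.norm_of_nonneg (by positivity),
      Real.sq_sqrt (by positivity), ← hS]
    exact (div_mul_cancel₀ _ hSpos.ne').le)
  refine le_trans ?_ hw
  set w := ((√(M / S) : ℝ) : ℂ) • b with hwdef
  have hj := norm_le_pi_norm w j
  have hk := norm_le_pi_norm w k
  have hprod : ‖(M : ℂ) * A⁻¹ j k‖ = ‖w j‖ * ‖w k‖ := by
    rw [← norm_mul]
    have : w j * w k = (M : ℂ) * A⁻¹ j k := by
      simp only [hwdef, Pi.smul_apply, smul_eq_mul, hbk]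
      have h1 : ((√(M / S) : ℝ) : ℂ) * ((√(M / S) : ℝ) : ℂ) * (S : ℂ) = M := by
        rw [← Complex.ofReal_mul, Real.mul_self_sqrt (by positivity), ← Complex.ofReal_mul,
          div_mul_cancel₀ _ hSpos.ne']
        simp
      calc _ = (((√(M / S) : ℝ) : ℂ) * ((√(M / S) : ℝ) : ℂ) * (S : ℂ)) * b j := by ring
        _ = _ := by rw [h1]
    rw [this]
  rw [hprod]
  calc (‖w j‖ * ‖w k‖) ^ 4 ≤ (‖w‖ * ‖w‖) ^ 4 := by gcongr
    _ = _ := by ring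

/-- Deviation of the empirical Gram matrix from its mean. -/
noncomputable def Dev {M K : ℕ} (σ : Fin K → ℝ) (X : Matrix (Fin M) (Fin K) ℂ) (j k : Fin K) : ℂ :=
  (if j = k then (σ k : ℂ) else 0) - (Xᴴ * X) j k / M

lemma trace_eq {M K : ℕ} [NeZero K] (X : Matrix (Fin M) (Fin K) ℂ) :
    Matrix.trace ((Matrix.of fun i j : Fin K => if i = j + 1 then (1 : ℂ) else 0)
      * (Xᴴ * X)⁻¹ * (Matrix.of fun i j : Fin K => if i = j + 1 then (1 : ℂ) else 0)ᴴ
      * (Xᵀ * X.map star)⁻¹)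
    = ∑ i, ∑ j, (Xᴴ * X)⁻¹ i j * (Xᴴ * X)⁻¹ (i + 1) (j + 1) := by
  have h1 : Xᵀ * X.map star = (Xᴴ * X)ᵀ := by
    rw [Matrix.transpose_mul]; rfl
  rw [h1, ← Matrix.transpose_nonsing_inv]
  set B := (Xᴴ * X)⁻¹
  set P : Matrix (Fin K) (Fin K) ℂ := Matrix.of fun i j : Fin K => if i = j + 1 then (1 : ℂ) else 0
    with hP
  rw [Matrix.mul_assoc, Matrix.mul_assoc, Matrix.trace_mul_comm, Matrix.mul_assoc, Matrix.trace]
  refine Finset.sum_congr rfl fun i _ => ?_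
  rw [Matrix.diag_apply, Matrix.mul_apply]
  refine Finset.sum_congr rfl fun j _ => ?_
  congr 1
  have h2 : ∀ a i, (Bᵀ * P) a i = B (i + 1) a := by
    intro a i
    simp [Matrix.mul_apply, hP]
  rw [Matrix.mul_assoc, Matrix.mul_apply]
  simp_rw [h2]
  simp [hP, Matrix.conjTranspose_apply, apply_ite]

lemma det_estimate {M K : ℕ} [NeZero K] (hM : 0 < M) (σ : Fin K → ℝ) (hσ : ∀ k, 0 < σ k)
    (X : Matrix (Fin M) (Fin K) ℂ) (hdet : IsUnit (Xᴴ * X).det) (R : ℝ) (hR : 0 ≤ R)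
    (hB : ∀ j k, ‖(M : ℂ) * (Xᴴ * X)⁻¹ j k‖ ≤ R) :
    ‖(M : ℂ) ^ 2 * (∑ i, ∑ j, (Xᴴ * X)⁻¹ i j * (Xᴴ * X)⁻¹ (i + 1) (j + 1))
        - ((∑ k' : Fin K, 1 / (σ k' * σ (k' + 1)) : ℝ) : ℂ)‖
      ≤ (K ^ 2 * ((∑ k, 1 / σ k) * (1 + ∑ k, 1 / σ k))) * ((1 + R) ^ 2 *
        ∑ j, ∑ k, ‖Dev σ X j k‖) := by
  have hM' : (0 : ℝ) < M := by exact_mod_cast hM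
  have hMc : (M : ℂ) ≠ 0 := by exact_mod_cast hM.ne'
  set c := ∑ k, 1 / σ k with hc
  set Y := ∑ j, ∑ k, ‖Dev σ X j k‖ with hY
  set A := Xᴴ * X with hA
  have hterm : ∀ k, 0 < 1 / σ k := fun k => by have := hσ k; positivity
  have hc0 : 0 ≤ c := Finset.sum_nonneg fun k _ => (hterm k).le
  have hY0 : 0 ≤ Y := by positivity
  set D : Matrix (Fin K) (Fin K) ℂ := Matrix.diagonal fun k => ((1 / σ k : ℝ) : ℂ) with hD
  set B : Matrix (Fin K) (Fin K) ℂ := (M : ℂ) • A⁻¹ with hBdef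
  have hBe : ∀ i j, B i j = (M : ℂ) * A⁻¹ i j := fun i j => rfl
  have hcle : ∀ k, 1 / σ k ≤ c := fun k =>
    Finset.single_le_sum (f := fun k => 1 / σ k) (fun k _ => (hterm k).le) (Finset.mem_univ k)
  have hDn : ∀ i j, ‖D i j‖ ≤ c := by
    intro i j
    rw [hD, Matrix.diagonal_apply]
    split_ifs with h
    · rw [Complex.norm_real, Real.norm_of_nonneg (hterm i).le]
      exact hcle i
    · simpa using hc0
  have hdiff : B - D = B * Matrix.of (Dev σ X) * D := by
    have e1 : Matrix.of (Dev σ X) = Matrix.diagonal (fun k => (σ k : ℂ)) - (M : ℂ)⁻¹ • A := by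
      ext j k
      simp only [Matrix.of_apply, Dev, Matrix.sub_apply, Matrix.diagonal_apply, Matrix.smul_apply,
        smul_eq_mul]
      rw [div_eq_inv_mul]
      split_ifs with h
      · rw [h]
      · rfl
    have e2 : Matrix.diagonal (fun k => (σ k : ℂ)) * D = 1 := by
      rw [hD, Matrix.diagonal_mul_diagonal, ← Matrix.diagonal_one]
      congr 1
      ext k
      have := (hσ k).ne'
      rw [← Complex.ofReal_mul, mul_one_div_cancel this]
      simp
    have e3 : B * ((M : ℂ)⁻¹ • A) = 1 := by
      rw [hBdef, Matrix.smul_mul, Matrix.mul_smul, smul_smul, mul_inv_cancel₀ hMc, one_smul,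
        Matrix.nonsing_inv_mul _ hdet]
    rw [e1, Matrix.mul_sub, Matrix.sub_mul, e3, Matrix.mul_assoc, e2, Matrix.mul_one,
      Matrix.one_mul]
  have hdn : ∀ i j, ‖B i j - D i j‖ ≤ R * Y * c := by
    intro i j
    rw [← Matrix.sub_apply, hdiff, hD, Matrix.mul_diagonal, norm_mul, Complex.norm_real,
      Real.norm_of_nonneg (hterm j).le]
    have : ‖(B * Matrix.of (Dev σ X)) i j‖ ≤ R * Y := by
      rw [Matrix.mul_apply, hY, Finset.mul_sum]
      refine (norm_sum_le _ _).trans (Finset.sum_le_sum fun l _ => ?_)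
      rw [norm_mul]
      have h1 : ‖Dev σ X l j‖ ≤ ∑ k, ‖Dev σ X l k‖ :=
        Finset.single_le_sum (f := fun k => ‖Dev σ X l k‖) (fun k _ => norm_nonneg _)
          (Finset.mem_univ j)
      exact mul_le_mul (hB i l) h1 (norm_nonneg _) hR
    exact mul_le_mul this (hcle j) (hterm j).le (by positivity)
  have e1 : (M : ℂ) ^ 2 * (∑ i, ∑ j, A⁻¹ i j * A⁻¹ (i + 1) (j + 1))
      = ∑ i, ∑ j, B i j * B (i + 1) (j + 1) := by
    simp_rw [Finset.mul_sum, hBe]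
    refine Finset.sum_congr rfl fun i _ => Finset.sum_congr rfl fun j _ => ?_
    ring
  have e2 : ((∑ k' : Fin K, 1 / (σ k' * σ (k' + 1)) : ℝ) : ℂ)
      = ∑ i, ∑ j, D i j * D (i + 1) (j + 1) := by
    push_cast
    refine Finset.sum_congr rfl fun i _ => ?_
    rw [Finset.sum_eq_single i]
    · simp [hD, mul_comm]
    · intro j _ hji
      simp [hD, Matrix.diagonal_apply_ne _ hji.symm]
    · simp
  rw [e1, e2, ← Finset.sum_sub_distrib]
  simp_rw [← Finset.sum_sub_distrib]
  have hone : ∀ i j, ‖B i j * B (i + 1) (j + 1) - D i j * D (i + 1) (j + 1)‖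
      ≤ (c * (1 + c)) * ((1 + R) ^ 2 * Y) := by
    intro i j
    have : B i j * B (i + 1) (j + 1) - D i j * D (i + 1) (j + 1)
      = (B i j - D i j) * B (i + 1) (j + 1) + D i j * (B (i + 1) (j + 1) - D (i + 1) (j + 1)) := by
      ring
    rw [this]
    calc _ ≤ ‖B i j - D i j‖ * ‖B (i + 1) (j + 1)‖
          + ‖D i j‖ * ‖B (i + 1) (j + 1) - D (i + 1) (j + 1)‖ := by
          refine (norm_add_le _ _).trans ?_
          rw [norm_mul, norm_mul]
      _ ≤ (R * Y * c) * R + c * (R * Y * c) := by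
          have := hdn i j
          have := hdn (i + 1) (j + 1)
          have := hB (i + 1) (j + 1)
          have := hDn i j
          rw [← hBe] at *
          gcongr
      _ = (c * (R * R + R * c)) * Y := by ring
      _ ≤ (c * ((1 + c) * (1 + R) ^ 2)) * Y := by
          gcongr
          nlinarith [mul_nonneg hR hc0, mul_nonneg hc0 (sq_nonneg R)]
      _ = _ := by ring
  calc _ ≤ ∑ i : Fin K, ∑ j : Fin K, (c * (1 + c)) * ((1 + R) ^ 2 * Y) := by
        refine (norm_sum_le _ _).trans (Finset.sum_le_sum fun i _ => ?_)
        exact (norm_sum_le _ _).trans (Finset.sum_le_sum fun j _ => hone i j)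
    _ = _ := by
        simp only [Finset.sum_const, Finset.card_univ, Fintype.card_fin, nsmul_eq_mul]
        ring

lemma final_det {M K : ℕ} [NeZero K] (hM : 0 < M) (σ : Fin K → ℝ) (hσ : ∀ k, 0 < σ k)
    (X : Matrix (Fin M) (Fin K) ℂ) (H : ℝ)
    (hH : ∀ w, qform X w ≤ M → ‖w‖ ^ 8 ≤ H) :
    ‖(M : ℂ) ^ 2 * (∑ i, ∑ j, (Xᴴ * X)⁻¹ i j * (Xᴴ * X)⁻¹ (i + 1) (j + 1))
        - ((∑ k' : Fin K, 1 / (σ k' * σ (k' + 1)) : ℝ) : ℂ)‖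
      ≤ (K ^ 2 * ((∑ k, 1 / σ k) * (1 + ∑ k, 1 / σ k))) * (8 * (1 + H) / √M +
        √M * (K ^ 2 * ∑ j, ∑ k, ‖Dev σ X j k‖ ^ 2)) := by
  have hM' : (0 : ℝ) < M := by exact_mod_cast hM
  obtain ⟨h1, h2⟩ := det_and_bound hM X H hH
  have hH0 : 0 ≤ H := le_trans (by positivity) (h2 0 0)
  set R := H ^ ((1 : ℝ) / 4) with hRdef
  have hR : 0 ≤ R := by positivity
  have hR4 : R ^ 4 = H := by
    rw [hRdef, ← Real.rpow_natCast, ← Real.rpow_mul hH0]; norm_num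
  have h3 := det_estimate hM σ hσ X h1 R hR (fun j k => by
    refine le_of_pow_le_pow_left₀ (n := 4) (by norm_num) hR ?_
    rw [hR4]; exact h2 j k)
  refine h3.trans ?_
  have hc0 : 0 ≤ ∑ k, 1 / σ k := Finset.sum_nonneg fun k _ => by have := hσ k; positivity
  apply mul_le_mul_of_nonneg_left _ (by positivity)
  set Y := ∑ j, ∑ k, ‖Dev σ X j k‖ with hY
  have hY2 : Y ^ 2 ≤ K ^ 2 * ∑ j, ∑ k, ‖Dev σ X j k‖ ^ 2 := by
    rw [hY, ← Fintype.sum_prod_type' (f := fun j k => ‖Dev σ X j k‖),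
      ← Fintype.sum_prod_type' (f := fun j k => ‖Dev σ X j k‖ ^ 2)]
    have := sq_sum_le_card_mul_sum_sq (s := (Finset.univ : Finset (Fin K × Fin K)))
      (f := fun p => ‖Dev σ X p.1 p.2‖)
    simp only [Finset.card_univ, Fintype.card_prod, Fintype.card_fin] at this
    push_cast at this
    rw [sq (K : ℝ)]
    exact this
  set s := √(M : ℝ) with hs
  have hs0 : 0 < s := Real.sqrt_pos.2 hM'
  have h4 : (1 + R) ^ 4 ≤ 8 * (1 + H) := by
    rw [← hR4]
    nlinarith [sq_nonneg (R - 1), sq_nonneg (R ^ 2 - 1), sq_nonneg (R * (R - 1)), sq_nonneg (R^2 - R),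
      mul_nonneg hR (sq_nonneg (R - 1)), sq_nonneg (R^2 - 2 * R + 1)]
  calc (1 + R) ^ 2 * Y ≤ (1 + R) ^ 4 / s + s * Y ^ 2 := by
        have e : (1 + R) ^ 4 / s + s * Y ^ 2 - (1 + R) ^ 2 * Y
          = (((1 + R) ^ 2 - s * Y) ^ 2 + (1 + R) ^ 2 * (s * Y)) / s := by
          field_simp; ring
        have : 0 ≤ (((1 + R) ^ 2 - s * Y) ^ 2 + (1 + R) ^ 2 * (s * Y)) / s := by
          have : 0 ≤ Y := by positivity
          positivity
        linarith
    _ ≤ _ := by gcongr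

section prob
variable {Ω : Type*} [MeasurableSpace Ω] {μ : Measure Ω} [IsProbabilityMeasure μ]

lemma rows_indep {M K : ℕ} (X : Ω → Matrix (Fin M) (Fin K) ℂ)
    (hm : ∀ i k, Measurable (fun ω => X ω i k))
    (hind : iIndepFun (fun (p : Fin M × Fin K) ω => X ω p.1 p.2) μ) :
    iIndepFun (fun (i : Fin M) ω => (fun k : Fin K => X ω i k)) μ := by
  have hp : ∀ i k, IsProbabilityMeasure (μ.map (fun ω => X ω i k)) := fun i k =>
    Measure.isProbabilityMeasure_map (hm i k).aemeasurable
  rw [iIndepFun_iff_map_fun_eq_pi_map (fun i => by fun_prop)]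
  have hrow : ∀ i, μ.map (fun ω => (fun k : Fin K => X ω i k))
      = Measure.pi (fun k => μ.map (fun ω => X ω i k)) := by
    intro i
    refine (iIndepFun_iff_map_fun_eq_pi_map (fun k => (hm i k).aemeasurable)).1 ?_
    exact hind.precomp (g := fun k : Fin K => (i, k)) (fun a b h => by simpa using h)
  simp_rw [hrow]
  have hpair := (iIndepFun_iff_map_fun_eq_pi_map
    (fun p : Fin M × Fin K => (hm p.1 p.2).aemeasurable)).1 hind
  set ν : Measure (Fin M → Fin K → ℂ) :=
    Measure.pi fun i => Measure.pi (fun k => μ.map (fun ω => X ω i k)) with hν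
  have hν1 : iIndepFun (fun (i : Fin M) (x : Fin M → Fin K → ℂ) => x i) ν :=
    iIndepFun_pi (X := fun i (y : Fin K → ℂ) => y) (fun i => by fun_prop)
  have hevi : ∀ i, ν.map (fun x => x i) = Measure.pi (fun k => μ.map (fun ω => X ω i k)) :=
    fun i => (measurePreserving_eval _ i).map_eq
  have hevk : ∀ i k, ν.map (fun x => x i k) = μ.map (fun ω => X ω i k) := by
    intro i k
    have : (fun x : Fin M → Fin K → ℂ => x i k) = (fun y : Fin K → ℂ => y k) ∘ (fun x => x i) := rfl
    rw [this, ← Measure.map_map (by fun_prop) (by fun_prop), hevi]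
    exact (measurePreserving_eval (fun k => μ.map (fun ω => X ω i k)) k).map_eq
  have hν2 : ∀ i, iIndepFun (fun (k : Fin K) (x : Fin M → Fin K → ℂ) => x i k) ν := by
    intro i
    rw [iIndepFun_iff_map_fun_eq_pi_map (fun k => Measurable.aemeasurable (by fun_prop))]
    simp_rw [hevk]
    exact hevi i
  have hν3 := iIndepFun_uncurry' (P := ν) (X := fun i k (x : Fin M → Fin K → ℂ) => x i k)
    (fun i k => by fun_prop) hν1 hν2
  have hpair2 := (iIndepFun_iff_map_fun_eq_pi_map
    (fun p : Fin M × Fin K => Measurable.aemeasurable (by fun_prop))).1 hν3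
  simp_rw [hevk] at hpair2
  rw [← hpair2] at hpair
  have hc : Measurable (fun (y : Fin M × Fin K → ℂ) (i : Fin M) (k : Fin K) => y (i, k)) := by
    fun_prop
  have hfin := congrArg (fun ρ => ρ.map (fun (y : Fin M × Fin K → ℂ) i k => y (i, k))) hpair
  beta_reduce at hfin
  rw [Measure.map_map hc (by fun_prop), Measure.map_map hc (by fun_prop)] at hfin
  refine hfin.trans ?_
  exact Measure.map_id

lemma row_bound {K : ℕ} (g : Fin K → Ω → ℂ) (hm : ∀ k, Measurable (g k)) (hind : iIndepFun g μ)
    (σ : Fin K → ℝ) (hσ : ∀ k, 0 < σ k) (hd : ∀ k, μ.map (g k) = complexGaussian (σ k))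
    (u : Fin K → ℂ) (t : ℝ) (ht : 0 ≤ t) (j : Fin K) :
    ∫⁻ ω, ENNReal.ofReal (Real.exp (-t * ‖∑ k, g k ω * u k‖ ^ 2)) ∂μ
      ≤ ENNReal.ofReal (1 + t * ‖u j‖ ^ 2 * σ j)⁻¹ := by
  have hσj := hσ j
  by_cases huj : u j = 0
  · simp only [huj, norm_zero, ne_eq, OfNat.ofNat_ne_zero, not_false_eq_true, zero_pow, mul_zero,
      zero_mul, add_zero, inv_one, ENNReal.ofReal_one]
    calc _ ≤ ∫⁻ ω, 1 ∂μ := by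
          apply lintegral_mono
          intro ω
          simp only [ENNReal.ofReal_le_one, Real.exp_le_one_iff]
          have : 0 ≤ t * ‖∑ k, g k ω * u k‖ ^ 2 := by positivity
          linarith
      _ = 1 := by simp
  set f : Fin K → Ω → ℂ := fun k ω => g k ω * (u k / u j) with hf
  have hfm : ∀ k, Measurable (f k) := fun k => by have := hm k; fun_prop
  have hfi : iIndepFun f μ := hind.comp (fun k z => z * (u k / u j)) (fun k => by fun_prop)
  have hI := hfi.indepFun_finsetSum_of_notMem hfm (s := Finset.univ.erase j) (i := j) (by simp)
  set W := ∑ k ∈ Finset.univ.erase j, f k with hW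
  have hWm : Measurable W := by
    have : W = fun ω => ∑ k ∈ Finset.univ.erase j, f k ω := by ext ω; simp [hW]
    rw [this]; fun_prop
  have hfj : f j = g j := by
    ext ω; simp [hf, huj]
  rw [hfj] at hI
  have hlaw := (indepFun_iff_map_prod_eq_prod_map_map hWm.aemeasurable (hm j).aemeasurable).1 hI
  have hsum : ∀ ω, ‖∑ k, g k ω * u k‖ ^ 2 = ‖u j‖ ^ 2 * ‖W ω + g j ω‖ ^ 2 := by
    intro ω
    rw [← mul_pow, ← norm_mul]
    congr 2
    have : W ω + g j ω = ∑ k, f k ω := by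
      rw [← Finset.sum_erase_add _ _ (Finset.mem_univ j), hW, Finset.sum_apply, hfj]
    rw [this, Finset.mul_sum]
    refine Finset.sum_congr rfl fun k _ => ?_
    simp only [hf]
    field_simp
  set t' := t * ‖u j‖ ^ 2 with ht'
  have ht'0 : 0 ≤ t' := by positivity
  set F : ℂ × ℂ → ℝ≥0∞ := fun p => ENNReal.ofReal (Real.exp (-t' * ‖p.1 + p.2‖ ^ 2)) with hF
  have hFm : Measurable F := by rw [hF]; fun_prop
  calc _ = ∫⁻ ω, F (W ω, g j ω) ∂μ := by
        refine lintegral_congr fun ω => ?_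
        simp only [hF, ht']
        rw [hsum]
        congr 2
        ring
    _ = ∫⁻ p, F p ∂((μ.map W).prod (complexGaussian (σ j))) := by
        rw [← hd j, ← hlaw, lintegral_map hFm (by fun_prop)]
    _ = ∫⁻ z, ∫⁻ x, F (z, x) ∂(complexGaussian (σ j)) ∂(μ.map W) := lintegral_prod _ hFm.aemeasurable
    _ ≤ ∫⁻ z, ENNReal.ofReal (1 + t' * σ j)⁻¹ ∂(μ.map W) := by
        apply lintegral_mono
        intro z
        exact aux_gauss_cplx (σ j) t' z hσj (by positivity) (Or.inl ht'0)
    _ = _ := by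
        have : IsProbabilityMeasure (μ.map W) := Measure.isProbabilityMeasure_map hWm.aemeasurable
        simp

lemma E_qform {M K : ℕ} [NeZero K] (hM : 0 < M) (X : Ω → Matrix (Fin M) (Fin K) ℂ)
    (hm : ∀ i k, Measurable (fun ω => X ω i k))
    (hind : iIndepFun (fun (p : Fin M × Fin K) ω => X ω p.1 p.2) μ)
    (σ : Fin K → ℝ) (hσ : ∀ k, 0 < σ k)
    (hd : ∀ i k, μ.map (fun ω => X ω i k) = complexGaussian (σ k))
    (s : ℝ) (hs : 0 < s) (hsσ : ∀ k, s ≤ σ k) (u : Fin K → ℂ) :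
    ∫⁻ ω, ENNReal.ofReal (Real.exp (-(qform (X ω) u / M))) ∂μ
      ≤ ENNReal.ofReal ((1 + s * ‖u‖ ^ 2 / M) ^ M)⁻¹ := by
  have hM' : (0 : ℝ) < M := by exact_mod_cast hM
  obtain ⟨j, hj⟩ : ∃ j, ‖u‖ = ‖u j‖ := by
    obtain ⟨j, hj⟩ := Finite.exists_max (fun k => ‖u k‖)
    exact ⟨j, le_antisymm ((pi_norm_le_iff_of_nonneg (norm_nonneg _)).2 hj) (norm_le_pi_norm u j)⟩
  have hr := rows_indep X hm hind
  have hprod : ∀ ω, ENNReal.ofReal (Real.exp (-(qform (X ω) u / M)))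
      = ∏ i, ENNReal.ofReal (Real.exp (-(1 / M : ℝ) * ‖∑ k, X ω i k * u k‖ ^ 2)) := by
    intro ω
    rw [← ENNReal.ofReal_prod_of_nonneg (fun _ _ => by positivity), ← Real.exp_sum,
      ← Finset.mul_sum]
    congr 2
    unfold qform
    ring
  simp_rw [hprod]
  have hcomp : iIndepFun (fun (i : Fin M) ω =>
      ENNReal.ofReal (Real.exp (-(1 / M : ℝ) * ‖∑ k, X ω i k * u k‖ ^ 2))) μ :=
    hr.comp (fun i (y : Fin K → ℂ) =>
      ENNReal.ofReal (Real.exp (-(1 / M : ℝ) * ‖∑ k, y k * u k‖ ^ 2))) (fun i => by fun_prop)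
  rw [lintegral_prod_eq_prod_lintegral_of_indepFun Finset.univ _ hcomp (fun i => by fun_prop)]
  calc _ ≤ ∏ i : Fin M, ENNReal.ofReal (1 + s * ‖u‖ ^ 2 / M)⁻¹ := by
        apply Finset.prod_le_prod' 
        intro i _
        refine (row_bound (μ := μ) (fun k ω => X ω i k) (fun k => hm i k)
          (hind.precomp (g := fun k : Fin K => (i, k)) (fun a b h => by simpa using h)) σ hσ (hd i) u
          (1 / M) (by positivity) j).trans ?_
        apply ENNReal.ofReal_le_ofReal
        rw [hj]
        apply inv_anti₀ (by positivity)
        have := mul_le_mul_of_nonneg_right (hsσ j) (by positivity : 0 ≤ ‖u j‖ ^ 2 / M)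
        calc _ = 1 + s * (‖u j‖ ^ 2 / M) := by ring
          _ ≤ 1 + σ j * (‖u j‖ ^ 2 / M) := by linarith
          _ = _ := by ring
    _ = _ := by
        rw [Finset.prod_const, Finset.card_univ, Fintype.card_fin,
          ← ENNReal.ofReal_pow (by positivity), inv_pow]

lemma E_fro {M K : ℕ} (X : Ω → Matrix (Fin M) (Fin K) ℂ)
    (hm : ∀ i k, Measurable (fun ω => X ω i k))
    (hind : iIndepFun (fun (p : Fin M × Fin K) ω => X ω p.1 p.2) μ)
    (σ : Fin K → ℝ) (hσ : ∀ k, 0 < σ k)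
    (hd : ∀ i k, μ.map (fun ω => X ω i k) = complexGaussian (σ k))
    (c : ℝ) (hc : 0 ≤ c) (hcσ : ∀ k, c * σ k ≤ 1 / 2) :
    ∫⁻ ω, ENNReal.ofReal (Real.exp (c * fro (X ω))) ∂μ
      ≤ ENNReal.ofReal (Real.exp (2 * c * M * ∑ k, σ k)) := by
  have hprod : ∀ ω, ENNReal.ofReal (Real.exp (c * fro (X ω)))
      = ∏ p : Fin M × Fin K, ENNReal.ofReal (Real.exp (-(-c) * ‖0 + X ω p.1 p.2‖ ^ 2)) := by
    intro ω
    rw [← ENNReal.ofReal_prod_of_nonneg (fun _ _ => by positivity), ← Real.exp_sum,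
      ← Finset.mul_sum]
    simp [fro]
  simp_rw [hprod]
  have hcomp : iIndepFun (fun (p : Fin M × Fin K) ω =>
      ENNReal.ofReal (Real.exp (-(-c) * ‖0 + X ω p.1 p.2‖ ^ 2))) μ :=
    hind.comp (fun p (y : ℂ) =>
      ENNReal.ofReal (Real.exp (-(-c) * ‖0 + y‖ ^ 2))) (fun i => by fun_prop)
  have hmm : ∀ p : Fin M × Fin K, Measurable (fun ω =>
      ENNReal.ofReal (Real.exp (-(-c) * ‖0 + X ω p.1 p.2‖ ^ 2))) := by
    intro p; have := hm p.1 p.2; fun_prop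
  rw [lintegral_prod_eq_prod_lintegral_of_indepFun Finset.univ _ hcomp hmm]
  calc _ ≤ ∏ p : Fin M × Fin K, ENNReal.ofReal (Real.exp (2 * c * σ p.2)) := by
        apply Finset.prod_le_prod' 
        intro p _
        have h1 := aux_gauss_cplx (σ p.2) (-c) 0 (hσ p.2) (by have := hcσ p.2; linarith) (Or.inr rfl)
        rw [← hd p.1 p.2, lintegral_map (by fun_prop) (hm p.1 p.2)] at h1
        refine h1.trans (ENNReal.ofReal_le_ofReal ?_)
        have h2 := hcσ p.2
        have h3 : 0 ≤ c * σ p.2 := mul_nonneg hc (hσ _).le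
        have h4 : (1 + -c * σ p.2)⁻¹ ≤ 1 + 2 * c * σ p.2 := by
          rw [inv_le_iff_one_le_mul₀ (by linarith)]
          nlinarith
        have := Real.add_one_le_exp (2 * c * σ p.2)
        linarith
    _ = _ := by
        rw [← ENNReal.ofReal_prod_of_nonneg (fun _ _ => by positivity), ← Real.exp_sum,
          ← Finset.mul_sum, Fintype.sum_prod_type]
        simp
        ring_nf
end prob

lemma pow_bound (s t : ℝ) (hs : 0 < s) (ht : 0 ≤ t) (R M : ℕ) (hR : 0 < R) (hM : R ≤ M) :
    ((1 + s * t ^ 2 / M) ^ M)⁻¹ ≤ (2 + 2 * R / s) ^ R * ((1 + t) ^ R)⁻¹ := by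
  have hM0 : 0 < M := lt_of_lt_of_le hR hM
  have hM' : (0 : ℝ) < M := by exact_mod_cast hM0
  have hR' : (0 : ℝ) < R := by exact_mod_cast hR
  set n := M / R with hn
  set y := s * t ^ 2 with hy
  have hy0 : 0 ≤ y := by positivity
  have h1 : n * R ≤ M := Nat.div_mul_le_self M R
  have h2 : (M : ℝ) ≤ 2 * (n * R) := by
    have hn1 : 1 ≤ n := Nat.div_pos hM hR
    have h3 : M < n * R + R := by
      have := Nat.lt_div_mul_add (a := M) hR
      exact this
    have : M ≤ 2 * (n * R) := by nlinarith
    exact_mod_cast this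
  have hb : 1 + y / (2 * R) ≤ (1 + y / M) ^ n := by
    have := one_add_mul_le_pow (a := y / M) (by have : 0 ≤ y / M := by positivity
                                                linarith) n
    refine le_trans ?_ this
    have : y / (2 * R) ≤ n * (y / M) := by
      rw [← mul_div_assoc, div_le_div_iff₀ (by positivity) hM']
      nlinarith
    linarith
  have hc : 1 + t ≤ (2 + 2 * R / s) * (1 + y / (2 * R)) := by
    have e : (2 + 2 * R / s) * (1 + y / (2 * R)) = 2 + t ^ 2 + 2 * R / s + y / R := by
      rw [hy]; field_simp; ring
    rw [e]
    have : 0 ≤ 2 * R / s + y / R := by positivity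
    nlinarith [sq_nonneg (t - 1)]
  have hd : (1 + t) ^ R ≤ (2 + 2 * R / s) ^ R * (1 + y / M) ^ M := by
    calc (1 + t) ^ R ≤ ((2 + 2 * R / s) * (1 + y / M) ^ n) ^ R := by
          gcongr
          refine hc.trans ?_
          gcongr
      _ = (2 + 2 * R / s) ^ R * (1 + y / M) ^ (n * R) := by rw [mul_pow, ← pow_mul]
      _ ≤ _ := by
          gcongr
          have : 0 ≤ y / M := by positivity
          linarith
  have hp1 : 0 < (1 + y / M) ^ M := by positivity
  have hp2 : 0 < (1 + t) ^ R := by positivity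
  rw [← div_eq_mul_inv, le_div_iff₀ hp2, inv_mul_le_iff₀ hp1, mul_comm]
  exact hd

lemma int_bound (K : ℕ) (s : ℝ) (hs : 0 < s) : ∃ C : ℝ, 0 ≤ C ∧ ∀ M : ℕ, 2 * K + 17 ≤ M →
    ∫⁻ u : Fin K → ℂ, ENNReal.ofReal ((1 + ‖u‖) ^ 16 * ((1 + s * ‖u‖ ^ 2 / M) ^ M)⁻¹)
      ≤ ENNReal.ofReal C := by
  have hfr : Module.finrank ℝ (Fin K → ℂ) = 2 * K := by
    rw [Module.finrank_pi_fintype]; simp [mul_comm]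
  have hfin := finite_integral_one_add_norm (E := Fin K → ℂ) (μ := volume)
    (r := ((2 * K + 1 : ℕ) : ℝ)) (by rw [hfr]; push_cast; linarith)
  set I := ∫⁻ u : Fin K → ℂ, ENNReal.ofReal ((1 + ‖u‖) ^ (-((2 * K + 1 : ℕ) : ℝ))) with hI
  set c := (2 + 2 * ((2 * K + 17 : ℕ) : ℝ) / s) ^ (2 * K + 17) with hc
  have hc0 : 0 ≤ c := by positivity
  refine ⟨c * I.toReal, by positivity, fun M hM => ?_⟩
  rw [ENNReal.ofReal_mul hc0, ENNReal.ofReal_toReal hfin.ne, hI, ← lintegral_const_mul _ (by fun_prop)]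
  apply lintegral_mono
  intro u
  beta_reduce
  rw [← ENNReal.ofReal_mul hc0]
  apply ENNReal.ofReal_le_ofReal
  have h := pow_bound s ‖u‖ hs (norm_nonneg _) (2 * K + 17) M (by omega) hM
  calc _ ≤ (1 + ‖u‖) ^ 16 * (c * ((1 + ‖u‖) ^ (2 * K + 17))⁻¹) := by gcongr
    _ = c * ((1 + ‖u‖) ^ (2 * K + 1))⁻¹ := by
        have : (0 : ℝ) < 1 + ‖u‖ := by positivity
        rw [show 2 * K + 17 = (2 * K + 1) + 16 by ring, pow_add]
        field_simp
    _ = _ := by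
        rw [Real.rpow_neg (by positivity), Real.rpow_natCast]

lemma exists_H (K : ℕ) [NeZero K] (σ : Fin K → ℝ) (hσ : ∀ k, 0 < σ k) :
    ∃ C : ℝ, ∃ M0 : ℕ, ∀ M : ℕ, M0 ≤ M → ∀ {Ω : Type*} [MeasurableSpace Ω] (μ : Measure Ω)
    [IsProbabilityMeasure μ]
    (X : Ω → Matrix (Fin M) (Fin K) ℂ)
    (_ : ∀ i k, Measurable (fun ω => X ω i k))
    (_ : iIndepFun (fun (p : Fin M × Fin K) ω => X ω p.1 p.2) μ)
    (_ : ∀ i k, μ.map (fun ω => X ω i k) = complexGaussian (σ k)),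
    ∃ H : Ω → ℝ, Integrable H μ ∧ ∫ ω, H ω ∂μ ≤ C ∧
      ∀ᵐ ω ∂μ, ∀ w, qform (X ω) w ≤ M → ‖w‖ ^ 8 ≤ H ω := by
  obtain ⟨j0, hj0⟩ := Finite.exists_min σ
  set s := σ j0 with hs
  obtain ⟨C1, hC1, hintg⟩ := int_bound K s (hσ j0)
  have hvpos : 0 < volume (Metric.closedBall (0 : Fin K → ℂ) 1) :=
    Metric.measure_closedBall_pos _ _ one_pos
  have hvfin : volume (Metric.closedBall (0 : Fin K → ℂ) 1) < ∞ := measure_closedBall_lt_top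
  set V := (volume (Metric.closedBall (0 : Fin K → ℂ) 1)).toReal with hV
  have hVpos : 0 < V := ENNReal.toReal_pos hvpos.ne' hvfin.ne
  have hV' : volume (Metric.closedBall (0 : Fin K → ℂ) 1) = ENNReal.ofReal V :=
    (ENNReal.ofReal_toReal hvfin.ne).symm
  obtain ⟨M1, hM1⟩ := exists_nat_ge (4 * K * ∑ k, σ k)
  refine ⟨Real.exp 2 / V * C1 + Real.exp (4 * K * ∑ k, σ k), max (2 * K + 17) M1, ?_⟩
  intro M hM Ω _ μ _ X hm hind hd
  have hMa : 2 * K + 17 ≤ M := (le_max_left _ _).trans hM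
  have hMb : M1 ≤ M := (le_max_right _ _).trans hM
  have hM0 : 0 < M := by omega
  have hM' : (0 : ℝ) < M := by exact_mod_cast hM0
  -- expectation of J
  have hEJ : ∫⁻ ω, Jint (X ω) ∂μ ≤ ENNReal.ofReal C1 := by
    unfold Jint
    rw [lintegral_lintegral_swap]
    · refine le_trans (lintegral_mono fun u => ?_) (hintg M hMa)
      simp_rw [ENNReal.ofReal_mul (p := (1 + ‖u‖) ^ 16) (by positivity)]
      rw [lintegral_const_mul _ (by unfold qform; fun_prop)]
      gcongr
      exact E_qform hM0 X hm hind σ hσ hd s (hσ j0) hj0 u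
    · apply Measurable.aemeasurable
      unfold qform Function.uncurry
      have : ∀ i k, Measurable (fun p : Ω × (Fin K → ℂ) => X p.1 i k) := fun i k =>
        (hm i k).comp measurable_fst
      fun_prop
  have hJm : Measurable (fun ω => Jint (X ω)) := by
    unfold Jint
    apply Measurable.lintegral_prod_right'
      (f := fun p : Ω × (Fin K → ℂ) =>
        ENNReal.ofReal ((1 + ‖p.2‖) ^ 16 * Real.exp (-(qform (X p.1) p.2 / M))))
    unfold qform
    have : ∀ i k, Measurable (fun p : Ω × (Fin K → ℂ) => X p.1 i k) := fun i k =>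
        (hm i k).comp measurable_fst
    fun_prop
  have hJfin : ∫⁻ ω, Jint (X ω) ∂μ ≠ ∞ := ne_top_of_le_ne_top ENNReal.ofReal_ne_top hEJ
  have hJae : ∀ᵐ ω ∂μ, Jint (X ω) < ∞ := ae_lt_top hJm hJfin
  have hJint : Integrable (fun ω => (Jint (X ω)).toReal) μ :=
    integrable_toReal_of_lintegral_ne_top hJm.aemeasurable hJfin
  have hJval : ∫ ω, (Jint (X ω)).toReal ∂μ ≤ C1 := by
    rw [integral_toReal hJm.aemeasurable hJae]
    exact ENNReal.toReal_le_of_le_ofReal hC1 hEJ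
  -- expectation of the exponential
  set c : ℝ := 2 * K / M with hc
  have hEf := E_fro X hm hind σ hσ hd c (by positivity) (fun k => by
    have h1 : σ k ≤ ∑ k, σ k :=
      Finset.single_le_sum (f := σ) (fun k _ => (hσ k).le) (Finset.mem_univ k)
    have h2 : 4 * K * ∑ k, σ k ≤ M := hM1.trans (by exact_mod_cast hMb)
    rw [hc, div_mul_eq_mul_div, div_le_iff₀ hM']
    have : (0 : ℝ) ≤ K := by positivity
    nlinarith)
  have hfm : Measurable (fun ω => Real.exp (c * fro (X ω))) := by
    unfold fro
    have := fun p : Fin M × Fin K => hm p.1 p.2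
    fun_prop
  have he : 2 * c * M * ∑ k, σ k = 4 * K * ∑ k, σ k := by
    rw [hc]; field_simp; ring
  rw [he] at hEf
  have hfint : Integrable (fun ω => Real.exp (c * fro (X ω))) μ := by
    rw [← lintegral_ofReal_ne_top_iff_integrable hfm.aestronglyMeasurable
      (ae_of_all _ fun ω => (Real.exp_pos _).le)]
    exact ne_top_of_le_ne_top ENNReal.ofReal_ne_top hEf
  have hfval : ∫ ω, Real.exp (c * fro (X ω)) ∂μ ≤ Real.exp (4 * K * ∑ k, σ k) := by
    rw [integral_eq_lintegral_of_nonneg_ae (ae_of_all _ fun ω => (Real.exp_pos _).le)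
      hfm.aestronglyMeasurable]
    exact ENNReal.toReal_le_of_le_ofReal (Real.exp_pos _).le hEf
  refine ⟨fun ω => Real.exp 2 / V * (Jint (X ω)).toReal + Real.exp (c * fro (X ω)),
    (hJint.const_mul _).add hfint, ?_, ?_⟩
  · rw [integral_add (hJint.const_mul _) hfint, integral_const_mul]
    have : 0 ≤ Real.exp 2 / V := by positivity
    have := mul_le_mul_of_nonneg_left hJval this
    linarith
  · filter_upwards [hJae] with ω hω w hw
    have h1 := J_lower hM0 (X ω) w hw
    rw [hV', ← ENNReal.ofReal_mul (by positivity)] at h1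
    have h2 := (ENNReal.ofReal_le_iff_le_toReal hω.ne).1 h1
    set J := (Jint (X ω)).toReal with hJ
    have h3 : -2 - 2 * K * fro (X ω) / M = -2 + -(c * fro (X ω)) := by rw [hc]; ring
    rw [h3, Real.exp_add, Real.exp_neg, Real.exp_neg] at h2
    set E := Real.exp (c * fro (X ω)) with hE
    have hEpos : 0 < E := Real.exp_pos _
    have hepos : 0 < Real.exp 2 := Real.exp_pos _
    have h4 : (‖w‖ ^ 8) ^ 2 ≤ (Real.exp 2 / V * J) * E := by
      have : (‖w‖ ^ 8) ^ 2 = ‖w‖ ^ 16 * ((Real.exp 2)⁻¹ * E⁻¹) * V * (Real.exp 2 / V * E) := by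
        field_simp
      rw [this]
      calc _ ≤ J * (Real.exp 2 / V * E) := by gcongr
        _ = _ := by ring
    have hJ0 : 0 ≤ Real.exp 2 / V * J := by positivity
    refine le_of_pow_le_pow_left₀ (n := 2) (by norm_num) (by positivity) ?_
    nlinarith [mul_nonneg hJ0 hEpos.le]

lemma var_real {Ω : Type*} [MeasurableSpace Ω] {μ : Measure Ω} [IsProbabilityMeasure μ] {M : ℕ}
    (f : Fin M → Ω → ℝ) (hf : ∀ i, MemLp (f i) 2 μ) (hi : iIndepFun f μ) (m C : ℝ)
    (hmean : ∀ i, ∫ ω, f i ω ∂μ = m) (hC : ∀ i, ∫ ω, f i ω ^ 2 ∂μ ≤ C) :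
    Integrable (fun ω => (∑ i, f i ω - M * m) ^ 2) μ ∧
      ∫ ω, (∑ i, f i ω - M * m) ^ 2 ∂μ ≤ M * C := by
  have hs : MemLp (fun ω => ∑ i, f i ω) 2 μ := memLp_finsetSum _ (fun i _ => hf i)
  have hmem : MemLp (fun ω => ∑ i, f i ω - M * m) 2 μ := hs.sub (memLp_const _)
  refine ⟨hmem.integrable_sq, ?_⟩
  have hv := IndepFun.variance_sum (s := Finset.univ) (fun i _ => hf i)
    (fun i _ j _ hij => hi.indepFun hij)
  have hmean2 : ∫ ω, ∑ i, f i ω ∂μ = M * m := by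
    rw [integral_finsetSum _ (fun i _ => (hf i).integrable (by norm_num))]
    simp [hmean]
  have hsum : (∑ i, f i) = fun ω => ∑ i, f i ω := by ext ω; simp
  rw [hsum, variance_eq_integral hs.aestronglyMeasurable.aemeasurable, hmean2] at hv
  rw [hv]
  calc _ ≤ ∑ i : Fin M, C := by
        apply Finset.sum_le_sum
        intro i _
        refine (variance_le_expectation_sq (hf i).aestronglyMeasurable).trans ?_
        simpa using hC i
    _ = _ := by simp

lemma dev_bound {Ω : Type*} [MeasurableSpace Ω] {μ : Measure Ω} [IsProbabilityMeasure μ] {M K : ℕ}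
    (hM : 0 < M) (X : Ω → Matrix (Fin M) (Fin K) ℂ)
    (hm : ∀ i k, Measurable (fun ω => X ω i k))
    (hind : iIndepFun (fun (p : Fin M × Fin K) ω => X ω p.1 p.2) μ)
    (σ : Fin K → ℝ) (hσ : ∀ k, 0 < σ k)
    (hd : ∀ i k, μ.map (fun ω => X ω i k) = complexGaussian (σ k)) (j k : Fin K) :
    Integrable (fun ω => ‖Dev σ (X ω) j k‖ ^ 2) μ ∧
    ∫ ω, ‖Dev σ (X ω) j k‖ ^ 2 ∂μ ≤ 2 * (∑ l, ∫ z : ℂ, ‖z‖ ^ 4 ∂(complexGaussian (σ l))) / M := by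
  have hM' : (0 : ℝ) < M := by exact_mod_cast hM
  set C := ∑ l, ∫ z : ℂ, ‖z‖ ^ 4 ∂(complexGaussian (σ l)) with hC
  have hL : ∀ i l (p : ℝ≥0), MemLp (fun ω => X ω i l) p μ := by
    intro i l p
    have := aux_memLp (σ l) p
    rw [← hd i l, memLp_map_measure_iff (by fun_prop) (hm i l).aemeasurable] at this
    exact this
  have h4 : ∀ i l, Integrable (fun ω => ‖X ω i l‖ ^ 4) μ ∧ ∫ ω, ‖X ω i l‖ ^ 4 ∂μ ≤ C := by
    intro i l
    constructor
    · have := (hL i l 4).integrable_norm_pow (by norm_num)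
      simpa using this
    · have : ∫ ω, ‖X ω i l‖ ^ 4 ∂μ = ∫ z : ℂ, ‖z‖ ^ 4 ∂(complexGaussian (σ l)) := by
        rw [← hd i l, integral_map (hm i l).aemeasurable (by fun_prop)]
      rw [this]
      exact Finset.single_le_sum (f := fun l => ∫ z : ℂ, ‖z‖ ^ 4 ∂(complexGaussian (σ l)))
        (fun l _ => integral_nonneg fun z => by positivity) (Finset.mem_univ l)
  set ξ : Fin M → Ω → ℂ := fun i ω => star (X ω i j) * X ω i k with hξ
  have hξm : ∀ i, Measurable (ξ i) := fun i => by
    have := hm i j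
    have := hm i k
    have hs : Measurable (fun ω => star (X ω i j)) := continuous_star.measurable.comp (hm i j)
    exact hs.mul (hm i k)
  have hξsq : ∀ i, Integrable (fun ω => ‖ξ i ω‖ ^ 2) μ ∧ ∫ ω, ‖ξ i ω‖ ^ 2 ∂μ ≤ C := by
    intro i
    have hb : ∀ ω, ‖ξ i ω‖ ^ 2 ≤ (‖X ω i j‖ ^ 4 + ‖X ω i k‖ ^ 4) / 2 := by
      intro ω
      simp only [hξ, norm_mul, norm_star]
      nlinarith [sq_nonneg (‖X ω i j‖ ^ 2 - ‖X ω i k‖ ^ 2)]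
    have hg : Integrable (fun ω => (‖X ω i j‖ ^ 4 + ‖X ω i k‖ ^ 4) / 2) μ :=
      ((h4 i j).1.add (h4 i k).1).div_const 2
    have h1 : Integrable (fun ω => ‖ξ i ω‖ ^ 2) μ := by
      refine hg.mono' ((hξm i).norm.pow_const 2).aestronglyMeasurable (ae_of_all _ fun ω => ?_)
      rw [Real.norm_of_nonneg (by positivity)]
      exact hb ω
    refine ⟨h1, (integral_mono h1 hg hb).trans ?_⟩
    rw [integral_div, integral_add (h4 i j).1 (h4 i k).1]
    have := (h4 i j).2
    have := (h4 i k).2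
    linarith
  have hξL : ∀ i, MemLp (ξ i) 2 μ := fun i =>
    (memLp_two_iff_integrable_sq_norm (hξm i).aestronglyMeasurable).2 (hξsq i).1
  set m : ℂ := if j = k then (σ k : ℂ) else 0 with hmdef
  have hξmean : ∀ i, ∫ ω, ξ i ω ∂μ = m := by
    intro i
    by_cases hjk : j = k
    · subst hjk
      have e : ∀ ω, ξ i ω = ((‖X ω i j‖ ^ 2 : ℝ) : ℂ) := by
        intro ω
        simp only [hξ]
        push_cast
        rw [← Complex.conj_mul']
        rfl
      simp_rw [e]
      rw [integral_complex_ofReal]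
      have : ∫ ω, ‖X ω i j‖ ^ 2 ∂μ = σ j := by
        rw [← aux_second (σ j) (hσ j), ← hd i j, integral_map (hm i j).aemeasurable (by fun_prop)]
      rw [this, hmdef]
      simp
    · have hI : IndepFun (fun ω => X ω i j) (fun ω => X ω i k) μ :=
        hind.indepFun (i := (i, j)) (j := (i, k)) (by simpa using hjk)
      have hI2 : IndepFun (fun ω => star (X ω i j)) (fun ω => X ω i k) μ :=
        hI.comp (φ := fun z : ℂ => star z) (ψ := fun z => z) continuous_star.measurable measurable_id
      have h1 := hI2.integral_fun_mul_eq_mul_integral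
        (continuous_star.measurable.comp (hm i j)).aestronglyMeasurable
        (hm i k).aestronglyMeasurable
      have h0 : ∫ ω, X ω i k ∂μ = 0 := by
        rw [← aux_mean (σ k), ← hd i k, integral_map (hm i k).aemeasurable (by fun_prop)]
      rw [h0, mul_zero] at h1
      rw [hmdef, if_neg hjk]
      exact h1
  have hξind : iIndepFun ξ μ := (rows_indep X hm hind).comp
    (fun i (y : Fin K → ℂ) => star (y j) * y k) (fun i => by
      have hs : Measurable (fun y : Fin K → ℂ => star (y j)) :=
        (continuous_star (R := ℂ)).measurable.comp (measurable_pi_apply j)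
      exact hs.mul (measurable_pi_apply k))
  have hre := var_real (fun i ω => (ξ i ω).re) (fun i => (hξL i).re)
    (hξind.comp (fun i z => z.re) (fun i => Complex.measurable_re)) m.re C
    (fun i => by
      have := integral_re ((hξL i).integrable (by norm_num))
      rw [hξmean i] at this
      exact this)
    (fun i => by
      refine le_trans (integral_mono (hξL i).re.integrable_sq (hξsq i).1 fun ω => ?_) (hξsq i).2
      have := Complex.abs_re_le_norm (ξ i ω)
      exact sq_le_sq.2 (by simpa using this))
  have him := var_real (fun i ω => (ξ i ω).im) (fun i => (hξL i).im)
    (hξind.comp (fun i z => z.im) (fun i => Complex.measurable_im)) m.im C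
    (fun i => by
      have := integral_im ((hξL i).integrable (by norm_num))
      rw [hξmean i] at this
      exact this)
    (fun i => by
      refine le_trans (integral_mono (hξL i).im.integrable_sq (hξsq i).1 fun ω => ?_) (hξsq i).2
      have := Complex.abs_im_le_norm (ξ i ω)
      exact sq_le_sq.2 (by simpa using this))
  have hdev : ∀ ω, ‖Dev σ (X ω) j k‖ ^ 2 = ((∑ i, (ξ i ω).re - M * m.re) ^ 2
      + (∑ i, (ξ i ω).im - M * m.im) ^ 2) / M ^ 2 := by
    intro ω
    have e : Dev σ (X ω) j k = (((-1 / M : ℝ)) : ℂ) * (∑ i, ξ i ω - M * m) := by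
      have hMc : (M : ℂ) ≠ 0 := by exact_mod_cast hM.ne'
      have : ((X ω)ᴴ * X ω) j k = ∑ i, ξ i ω := by
        simp [Matrix.mul_apply, hξ]
      rw [Dev, this, ← hmdef]
      push_cast
      field_simp
      ring
    rw [e, norm_mul, mul_pow, Complex.norm_real, Complex.sq_norm (_ - _), Complex.normSq_apply]
    simp
    ring
  simp_rw [hdev]
  refine ⟨(hre.1.add him.1).div_const _, ?_⟩
  rw [integral_div, integral_add hre.1 him.1, div_le_div_iff₀ (by positivity) hM']
  have := hre.2
  have := him.2
  nlinarith

lemma meas_det {Ω : Type*} [MeasurableSpace Ω] {K : ℕ} (A : Ω → Matrix (Fin K) (Fin K) ℂ)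
    (hA : ∀ i j, Measurable fun ω => A ω i j) : Measurable fun ω => (A ω).det := by
  simp only [Matrix.det_apply']
  exact Finset.measurable_fun_sum _ fun p _ =>
    (Finset.measurable_fun_prod _ fun i _ => hA _ _).const_mul _

lemma meas_inv {Ω : Type*} [MeasurableSpace Ω] {K : ℕ} (A : Ω → Matrix (Fin K) (Fin K) ℂ)
    (hA : ∀ i j, Measurable fun ω => A ω i j) (i j : Fin K) :
    Measurable fun ω => (A ω)⁻¹ i j := by
  simp only [Matrix.inv_def, Ring.inverse_eq_inv', Matrix.smul_apply, smul_eq_mul,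
    Matrix.adjugate_apply]
  refine (meas_det A hA).inv.mul (meas_det _ fun a b => ?_)
  by_cases h : a = j
  · subst h
    simp only [Matrix.updateRow_self]
    exact measurable_const
  · simp only [Matrix.updateRow_ne h]
    exact hA a b

lemma key_bound (K : ℕ) [NeZero K] (σ : Fin K → ℝ) (hσ : ∀ k, 0 < σ k) :
    ∃ D : ℝ, ∃ M0 : ℕ, ∀ M : ℕ, M0 ≤ M → ∀ {Ω : Type*} [MeasurableSpace Ω] (μ : Measure Ω)
    [IsProbabilityMeasure μ]
    (X : Ω → Matrix (Fin M) (Fin K) ℂ)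
    (_ : ∀ i k, Measurable (fun ω => X ω i k))
    (_ : iIndepFun (fun (p : Fin M × Fin K) ω => X ω p.1 p.2) μ)
    (_ : ∀ i k, μ.map (fun ω => X ω i k) = complexGaussian (σ k)),
    ‖(M : ℂ) ^ 2 * (∫ ω, ∑ i, ∑ j, ((X ω)ᴴ * X ω)⁻¹ i j * ((X ω)ᴴ * X ω)⁻¹ (i + 1) (j + 1) ∂μ)
        - ((∑ k' : Fin K, 1 / (σ k' * σ (k' + 1)) : ℝ) : ℂ)‖ ≤ D / √M := by
  obtain ⟨C, M1, hC⟩ := exists_H K σ hσ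
  set c : ℝ := K ^ 2 * ((∑ k, 1 / σ k) * (1 + ∑ k, 1 / σ k)) with hc
  have hc0 : 0 ≤ c := by
    have : 0 ≤ ∑ k, 1 / σ k := Finset.sum_nonneg fun k _ => by
      have := hσ k
      positivity
    positivity
  set C4 := ∑ l, ∫ z : ℂ, ‖z‖ ^ 4 ∂(complexGaussian (σ l)) with hC4
  refine ⟨c * (8 * (1 + C) + K ^ 2 * (K * (K * (2 * C4)))), max M1 1, ?_⟩
  intro M hM Ω _ μ _ X hm hind hd
  have hM0 : 0 < M := by
    have := (le_max_right M1 1).trans hM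
    omega
  have hM' : (0 : ℝ) < M := by exact_mod_cast hM0
  have hsq : (0 : ℝ) < √M := Real.sqrt_pos.2 hM'
  obtain ⟨H, hHi, hHC, hH⟩ := hC M ((le_max_left _ _).trans hM) μ X hm hind hd
  have hdev := fun j k => dev_bound hM0 X hm hind σ hσ hd j k
  set ρ : ℂ := ((∑ k' : Fin K, 1 / (σ k' * σ (k' + 1)) : ℝ) : ℂ) with hρ
  set T : Ω → ℂ := fun ω =>
    ∑ i, ∑ j, ((X ω)ᴴ * X ω)⁻¹ i j * ((X ω)ᴴ * X ω)⁻¹ (i + 1) (j + 1) with hT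
  have hA : ∀ i j, Measurable fun ω => ((X ω)ᴴ * X ω) i j := by
    intro i j
    simp only [Matrix.mul_apply, Matrix.conjTranspose_apply]
    exact Finset.measurable_fun_sum _ fun l _ =>
      ((continuous_star (R := ℂ)).measurable.comp (hm l i)).mul (hm l j)
  have hTm : Measurable T := Finset.measurable_fun_sum _ fun i _ =>
    Finset.measurable_fun_sum _ fun j _ => (meas_inv _ hA _ _).mul (meas_inv _ hA _ _)
  have hDi : Integrable (fun ω => ∑ j, ∑ k, ‖Dev σ (X ω) j k‖ ^ 2) μ :=
    integrable_finsetSum _ fun j _ => integrable_finsetSum _ fun k _ => (hdev j k).1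
  have hDb : ∫ ω, ∑ j, ∑ k, ‖Dev σ (X ω) j k‖ ^ 2 ∂μ ≤ K * (K * (2 * C4 / M)) := by
    rw [integral_finsetSum _ fun j _ => integrable_finsetSum _ fun k _ => (hdev j k).1]
    calc _ ≤ ∑ j : Fin K, ∑ k : Fin K, 2 * C4 / M := by
          refine Finset.sum_le_sum fun j _ => ?_
          rw [integral_finsetSum _ fun k _ => (hdev j k).1]
          exact Finset.sum_le_sum fun k _ => (hdev j k).2
      _ = _ := by simp
  set B : Ω → ℝ := fun ω => c * (8 * (1 + H ω) / √M +
        √M * (K ^ 2 * ∑ j, ∑ k, ‖Dev σ (X ω) j k‖ ^ 2)) with hB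
  have hi1 : Integrable (fun ω => 8 * (1 + H ω) / √M) μ :=
    (((integrable_const 1).add hHi).const_mul 8).div_const _
  have hi2 : Integrable (fun ω => √M * (K ^ 2 * ∑ j, ∑ k, ‖Dev σ (X ω) j k‖ ^ 2)) μ :=
    (hDi.const_mul _).const_mul _
  have hBi : Integrable B μ := (hi1.add hi2).const_mul _
  have hle : ∀ᵐ ω ∂μ, ‖(M : ℂ) ^ 2 * T ω - ρ‖ ≤ B ω := by
    filter_upwards [hH] with ω hω
    exact final_det hM0 σ hσ (X ω) (H ω) hω
  have hFi : Integrable (fun ω => (M : ℂ) ^ 2 * T ω - ρ) μ :=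
    hBi.mono' ((hTm.const_mul _).sub_const _).aestronglyMeasurable hle
  have hMc : (M : ℂ) ^ 2 ≠ 0 := pow_ne_zero _ (by exact_mod_cast hM0.ne')
  have hMT : Integrable (fun ω => (M : ℂ) ^ 2 * T ω) μ := by
    have := hFi.add (integrable_const ρ)
    refine this.congr (Eventually.of_forall fun ω => ?_)
    simp
  have hintg : ∫ ω, ((M : ℂ) ^ 2 * T ω - ρ) ∂μ = (M : ℂ) ^ 2 * ∫ ω, T ω ∂μ - ρ := by
    rw [integral_sub hMT (integrable_const ρ), integral_const_mul]
    simp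
  rw [← hintg]
  refine (norm_integral_le_of_norm_le hBi hle).trans ?_
  have hBe : ∫ ω, B ω ∂μ = c * (8 * (1 + ∫ ω, H ω ∂μ) / √M +
        √M * (K ^ 2 * ∫ ω, ∑ j, ∑ k, ‖Dev σ (X ω) j k‖ ^ 2 ∂μ)) := by
    rw [hB, integral_const_mul, integral_add hi1 hi2, integral_div, integral_const_mul,
      integral_const_mul, integral_const_mul, integral_add (integrable_const 1) hHi]
    simp
  rw [hBe]
  calc _ ≤ c * (8 * (1 + C) / √M + √M * (K ^ 2 * (K * (K * (2 * C4 / M))))) := by gcongr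
    _ = _ := by
      have : (M : ℝ) = √M * √M := (Real.mul_self_sqrt hM'.le).symm
      have h2 : √M * (K ^ 2 * (K * (K * (2 * C4 / (√M * √M)))))
        = (K ^ 2 * (K * (K * (2 * C4)))) / √M := by
        field_simp
      rw [← this] at h2
      rw [h2]
      ring

theorem stmt_11
    {Ω : Type*} [MeasurableSpace Ω] (μ : Measure Ω) [IsProbabilityMeasure μ]
    (K : ℕ) [NeZero K] (hK : 1 ≤ K)
    (σsq : Fin K → ℝ) (hσ : ∀ k, 0 < σsq k)
    (G : ∀ M : ℕ, Ω → Matrix (Fin M) (Fin K) ℂ)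
    (hG : ∀ M, Measurable (G M))
    (hGindep : ∀ M, K < M → iIndepFun
      (fun (p : Fin M × Fin K) ω => G M ω p.1 p.2) μ)
    (hGdist : ∀ M, K < M → ∀ (i : Fin M) (k : Fin K),
      μ.map (fun ω => G M ω i k) = complexGaussian (σsq k))
    (Pi : Matrix (Fin K) (Fin K) ℂ)
    (hPi : Pi = Matrix.of fun i j : Fin K => if i = j + 1 then (1 : ℂ) else 0) :
    Tendsto
      (fun M : ℕ => ((M : ℂ) * ((M : ℂ) - (K : ℂ))) *
        ∫ ω, Matrix.trace
          (Pi * ((G M ω)ᴴ * G M ω)⁻¹ * Piᴴ * ((G M ω)ᵀ * (G M ω).map star)⁻¹) ∂μ)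
      atTop
      (nhds (↑(∑ k' : Fin K, 1 / (σsq k' * σsq (k' + 1))) : ℂ)) := by
  subst hPi
  simp only [trace_eq]
  obtain ⟨D, M0, hD⟩ := key_bound K σsq hσ
  set ρ : ℂ := ((∑ k' : Fin K, 1 / (σsq k' * σsq (k' + 1)) : ℝ) : ℂ) with hρ
  set I : ℕ → ℂ := fun M => ∫ ω, ∑ i, ∑ j, ((G M ω)ᴴ * G M ω)⁻¹ i j *
    ((G M ω)ᴴ * G M ω)⁻¹ (i + 1) (j + 1) ∂μ with hI
  have hnat : Tendsto (fun M : ℕ => (M : ℝ)) atTop atTop := tendsto_natCast_atTop_atTop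
  have h1 : Tendsto (fun M : ℕ => (M : ℂ) ^ 2 * I M) atTop (nhds ρ) := by
    rw [tendsto_iff_norm_sub_tendsto_zero]
    have hz : Tendsto (fun M : ℕ => D / √(M : ℝ)) atTop (nhds 0) :=
      (Real.tendsto_sqrt_atTop.comp hnat).const_div_atTop D
    refine squeeze_zero' (Eventually.of_forall fun _ => norm_nonneg _) ?_ hz
    filter_upwards [eventually_ge_atTop M0, eventually_gt_atTop K] with M hM hMK
    exact hD M hM μ (G M)
      (fun i k => (measurable_pi_apply k).comp ((measurable_pi_apply i).comp (hG M)))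
      (hGindep M hMK) (hGdist M hMK)
  have h2 : Tendsto (fun M : ℕ => 1 - (K : ℂ) / (M : ℂ)) atTop (nhds 1) := by
    have : Tendsto (fun M : ℕ => (K : ℂ) / (M : ℂ)) atTop (nhds 0) :=
      tendsto_const_div_atTop_nhds_zero_nat (K : ℂ)
    simpa using this.const_sub 1
  have h3 := h2.mul h1
  rw [one_mul] at h3
  refine h3.congr' ?_
  filter_upwards [eventually_gt_atTop 0] with M hM
  have : (M : ℂ) ≠ 0 := by exact_mod_cast hM.ne'
  field_simp
  rfl
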